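/- Let n be a natural number, let Π : Fin n → Fin n → ((Fin n → ℝ) → ℝ) be a smooth bivector field on ℝⁿ in coordinates (smooth, antisymmetric in its indices), and let H : Fin n → Fin n → Fin n → ((Fin n → ℝ) → ℝ) be a family of smooth functions totally antisymmetric in its three indices. Assume the WZW–Poisson condition: for all indices i, j, k and all points x, Σ_l ( Π i l · ∂_l(Π j k) + Π j l · ∂_l(Π k i) + Π k l · ∂_l(Π i j) )(x) = Σ_{l,m,p} ( Π i l · Π j m · Π k p · H l m p )(x). Then for all smooth functions f, g, h : (Fin n → ℝ) → ℝ and all points x, the twisted Jacobi identity holds: {f,{g,h}}(x) + {g,{h,f}}(x) + {h,{f,g}}(x) = Σ_{i,j,k,l,m,p} ( Π i l · Π j m · Π k p · H l m p )(x) · ∂_i f(x) · ∂_j g(x) · ∂_k h(x), where {f,g} := Σ_{i,j} (Π i j) · (∂_i f) · (∂_j g). -/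

import Mathlib

/-- Partial derivative of `f : (Fin n → ℝ) → ℝ` along the `i`-th standard
coordinate direction. -/
noncomputable def pderiv' {n : ℕ} (i : Fin n) (f : (Fin n → ℝ) → ℝ)
    (x : Fin n → ℝ) : ℝ :=
  fderiv ℝ f x (Pi.single i 1)

/-- The bracket associated to a bivector field `P` in coordinates:
`{f,g} := Σ_{i,j} P i j · ∂_i f · ∂_j g`. -/
noncomputable def pbracket {n : ℕ} (P : Fin n → Fin n → ((Fin n → ℝ) → ℝ))
    (f g : (Fin n → ℝ) → ℝ) (x : Fin n → ℝ) : ℝ :=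
  ∑ i, ∑ j, P i j x * pderiv' i f x * pderiv' j g x

theorem contDiff_pderiv' {n : ℕ} {f : (Fin n → ℝ) → ℝ} (hf : ContDiff ℝ (⊤ : ℕ∞) f)
    (i : Fin n) : ContDiff ℝ (⊤ : ℕ∞) (pderiv' i f) := by
  unfold pderiv'
  exact (hf.fderiv_right (m := (⊤ : ℕ∞)) (by simp)).clm_apply contDiff_const

theorem pderiv'_comm {n : ℕ} {f : (Fin n → ℝ) → ℝ} (hf : ContDiff ℝ (⊤ : ℕ∞) f)
    (i j : Fin n) (x : Fin n → ℝ) :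
    pderiv' i (pderiv' j f) x = pderiv' j (pderiv' i f) x := by
  have hd : DifferentiableAt ℝ (fderiv ℝ f) x :=
    ((hf.fderiv_right (m := (⊤ : ℕ∞)) (by simp)).differentiable (by simp)) x
  have key (a b : Fin n) : pderiv' a (pderiv' b f) x =
      fderiv ℝ (fderiv ℝ f) x (Pi.single a 1) (Pi.single b 1) := by
    change fderiv ℝ (fun y => fderiv ℝ f y (Pi.single b 1)) x (Pi.single a 1) = _
    rw [fderiv_clm_apply hd (differentiableAt_const _)]
    simp
  rw [key, key]
  exact (hf.contDiffAt.isSymmSndFDerivAt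
    (by simpa using WithTop.coe_le_coe.2 (le_top (a := (2 : ℕ∞))))) _ _

theorem pderiv'_pbracket {n : ℕ} {P : Fin n → Fin n → ((Fin n → ℝ) → ℝ)}
    (hP : ∀ i j, ContDiff ℝ (⊤ : ℕ∞) (P i j)) {g h : (Fin n → ℝ) → ℝ}
    (hg : ContDiff ℝ (⊤ : ℕ∞) g) (hh : ContDiff ℝ (⊤ : ℕ∞) h) (l : Fin n) (x : Fin n → ℝ) :
    pderiv' l (pbracket P g h) x = ∑ j, ∑ k,
      (pderiv' l (P j k) x * pderiv' j g x * pderiv' k h x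
        + P j k x * pderiv' l (pderiv' j g) x * pderiv' k h x
        + P j k x * pderiv' j g x * pderiv' l (pderiv' k h) x) := by
  have diff {u : (Fin n → ℝ) → ℝ} (hu : ContDiff ℝ (⊤ : ℕ∞) u) :
      HasFDerivAt u (fderiv ℝ u x) x := (hu.differentiable (by simp) x).hasFDerivAt
  have H := HasFDerivAt.fun_sum (u := Finset.univ) fun j _ =>
    HasFDerivAt.fun_sum (u := Finset.univ) fun k _ =>
      ((diff (hP j k)).mul (diff (contDiff_pderiv' hg j))).mul (diff (contDiff_pderiv' hh k))
  have e := congrArg (fun L => L (Pi.single l 1)) H.fderiv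
  refine Eq.trans e ?_
  simp only [sum_apply, add_apply,
    smul_apply, smul_eq_mul, Pi.mul_apply]
  refine Finset.sum_congr rfl fun j _ => Finset.sum_congr rfl fun k _ => ?_
  simp only [← pderiv'.eq_1]
  ring

/-- The contraction of the Hessian of `g` with the Hamiltonian vector fields of `f` and `h`. -/
noncomputable def hessianTerm {n : ℕ} (P : Fin n → Fin n → ((Fin n → ℝ) → ℝ))
    (f g h : (Fin n → ℝ) → ℝ) (x : Fin n → ℝ) : ℝ :=
  ∑ i, ∑ l, ∑ j, ∑ k,
    P i l x * P j k x * pderiv' i f x * pderiv' l (pderiv' j g) x * pderiv' k h x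

theorem hessianTerm_swap {n : ℕ} {P : Fin n → Fin n → ((Fin n → ℝ) → ℝ)}
    (hP : ∀ i j, P i j = fun x => -P j i x) {g : (Fin n → ℝ) → ℝ}
    (hg : ContDiff ℝ (⊤ : ℕ∞) g) (f h : (Fin n → ℝ) → ℝ) (x : Fin n → ℝ) :
    hessianTerm P h g f x = hessianTerm P f g h x := by
  have anti (a b) : P a b x = -P b a x := congrFun (hP a b) x
  have reorder (F : Fin n → Fin n → Fin n → Fin n → ℝ) :
      ∑ i, ∑ l, ∑ j, ∑ k, F i l j k = ∑ k, ∑ j, ∑ l, ∑ i, F i l j k := by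
    simp only [← Fintype.sum_prod_type']
    exact Fintype.sum_equiv
      { toFun := fun a => (a.2.2.2, a.2.2.1, a.2.1, a.1)
        invFun := fun a => (a.2.2.2, a.2.2.1, a.2.1, a.1)
        left_inv := fun _ => rfl
        right_inv := fun _ => rfl } _ _ fun _ => rfl
  unfold hessianTerm
  rw [reorder]
  refine Finset.sum_congr rfl fun i _ => Finset.sum_congr rfl fun l _ =>
    Finset.sum_congr rfl fun j _ => Finset.sum_congr rfl fun k _ => ?_
  rw [anti k j, anti l i, pderiv'_comm hg j l]
  ring

theorem pbracket_pbracket {n : ℕ} {P : Fin n → Fin n → ((Fin n → ℝ) → ℝ)}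
    (hP : ∀ i j, ContDiff ℝ (⊤ : ℕ∞) (P i j)) (hanti : ∀ i j, P i j = fun x => -P j i x)
    (f : (Fin n → ℝ) → ℝ) {g h : (Fin n → ℝ) → ℝ}
    (hg : ContDiff ℝ (⊤ : ℕ∞) g) (hh : ContDiff ℝ (⊤ : ℕ∞) h) (x : Fin n → ℝ) :
    pbracket P f (pbracket P g h) x =
      (∑ i, ∑ j, ∑ k, (∑ l, P i l x * pderiv' l (P j k) x)
        * pderiv' i f x * pderiv' j g x * pderiv' k h x)
      + hessianTerm P f g h x - hessianTerm P f h g x := by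
  have anti (a b) : P a b x = -P b a x := congrFun (hanti a b) x
  have first : (∑ i, ∑ j, ∑ k, (∑ l, P i l x * pderiv' l (P j k) x)
        * pderiv' i f x * pderiv' j g x * pderiv' k h x) =
      ∑ i, ∑ l, ∑ j, ∑ k, P i l x * pderiv' l (P j k) x
        * pderiv' i f x * pderiv' j g x * pderiv' k h x := by
    refine Finset.sum_congr rfl fun i _ => ?_
    simp only [Finset.sum_mul]
    conv_rhs => rw [Finset.sum_comm]
    refine Finset.sum_congr rfl fun j _ => ?_
    rw [Finset.sum_comm]
  have second : hessianTerm P f h g x = ∑ i, ∑ l, ∑ j, ∑ k,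
      P i l x * P k j x * pderiv' i f x * pderiv' l (pderiv' k h) x * pderiv' j g x :=
    Finset.sum_congr rfl fun i _ => Finset.sum_congr rfl fun l _ => Finset.sum_comm
  rw [first, second, hessianTerm]
  simp only [pbracket.eq_1 P f, pderiv'_pbracket hP hg hh, Finset.mul_sum,
    ← Finset.sum_add_distrib, ← Finset.sum_sub_distrib]
  refine Finset.sum_congr rfl fun i _ => Finset.sum_congr rfl fun l _ =>
    Finset.sum_congr rfl fun j _ => Finset.sum_congr rfl fun k _ => ?_
  rw [anti k j]
  ring

theorem wzw_poisson_implies_twisted_jacobi {n : ℕ}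
    (P : Fin n → Fin n → ((Fin n → ℝ) → ℝ))
    (H : Fin n → Fin n → Fin n → ((Fin n → ℝ) → ℝ))
    (hPsmooth : ∀ i j, ContDiff ℝ (⊤ : ℕ∞) (P i j))
    (hPanti : ∀ i j, P i j = fun x => -P j i x)
    (hHsmooth : ∀ i j k, ContDiff ℝ (⊤ : ℕ∞) (H i j k))
    (hHanti₁ : ∀ i j k, H i j k = fun x => -H j i k x)
    (hHanti₂ : ∀ i j k, H i j k = fun x => -H i k j x)
    (hWZW : ∀ i j k, ∀ x : Fin n → ℝ,
      (∑ l, (P i l x * pderiv' l (P j k) x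
           + P j l x * pderiv' l (P k i) x
           + P k l x * pderiv' l (P i j) x))
      = ∑ l, ∑ m, ∑ p, P i l x * P j m x * P k p x * H l m p x) :
    ∀ f g h : (Fin n → ℝ) → ℝ, ContDiff ℝ (⊤ : ℕ∞) f → ContDiff ℝ (⊤ : ℕ∞) g →
      ContDiff ℝ (⊤ : ℕ∞) h → ∀ x : Fin n → ℝ,
    pbracket P f (pbracket P g h) x + pbracket P g (pbracket P h f) x
      + pbracket P h (pbracket P f g) x
    = ∑ i, ∑ j, ∑ k, ∑ l, ∑ m, ∑ p,
        (P i l x * P j m x * P k p x * H l m p x)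
        * pderiv' i f x * pderiv' j g x * pderiv' k h x := by
  intro f g h hf hg hh x
  rw [pbracket_pbracket hPsmooth hPanti f hg hh, pbracket_pbracket hPsmooth hPanti g hh hf,
    pbracket_pbracket hPsmooth hPanti h hf hg, hessianTerm_swap hPanti hg f h,
    hessianTerm_swap hPanti hh f g, hessianTerm_swap hPanti hf g h]
  have cyclic (F : Fin n → Fin n → Fin n → ℝ) :
      ∑ i, ∑ j, ∑ k, F i j k = ∑ k, ∑ i, ∑ j, F i j k := by
    simp only [Finset.sum_comm (s := Finset.univ) (t := Finset.univ) (f := F _)]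
    exact Finset.sum_comm
  have hR : (∑ i, ∑ j, ∑ k, ∑ l, ∑ m, ∑ p,
        (P i l x * P j m x * P k p x * H l m p x)
        * pderiv' i f x * pderiv' j g x * pderiv' k h x) =
      ∑ i, ∑ j, ∑ k, (∑ l, (P i l x * pderiv' l (P j k) x
           + P j l x * pderiv' l (P k i) x
           + P k l x * pderiv' l (P i j) x))
        * pderiv' i f x * pderiv' j g x * pderiv' k h x := by
    simp only [hWZW, Finset.sum_mul]
  rw [hR, cyclic fun j k i => (∑ l, P j l x * pderiv' l (P k i) x)
      * pderiv' j g x * pderiv' k h x * pderiv' i f x,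
    ← cyclic fun i j k => (∑ l, P k l x * pderiv' l (P i j) x)
      * pderiv' k h x * pderiv' i f x * pderiv' j g x]
  have split : (∑ i, ∑ j, ∑ k, (∑ l, (P i l x * pderiv' l (P j k) x
           + P j l x * pderiv' l (P k i) x
           + P k l x * pderiv' l (P i j) x))
        * pderiv' i f x * pderiv' j g x * pderiv' k h x) =
      (∑ i, ∑ j, ∑ k, (∑ l, P i l x * pderiv' l (P j k) x)
        * pderiv' i f x * pderiv' j g x * pderiv' k h x)
      + (∑ i, ∑ j, ∑ k, (∑ l, P j l x * pderiv' l (P k i) x)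
        * pderiv' j g x * pderiv' k h x * pderiv' i f x)
      + ∑ i, ∑ j, ∑ k, (∑ l, P k l x * pderiv' l (P i j) x)
        * pderiv' k h x * pderiv' i f x * pderiv' j g x := by
    simp only [← Finset.sum_add_distrib]
    refine Finset.sum_congr rfl fun i _ => Finset.sum_congr rfl fun j _ =>
      Finset.sum_congr rfl fun k _ => ?_
    simp only [Finset.sum_add_distrib]
    ring
  rw [split]
  ring
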